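/- Let Γ be a monoid, R a commutative ring with identity, A a Γ-graded associative R-algebra, and B a Γ-algebra. Let φ : P → M be a projective cover in the category A-Γ-gr of Γ-graded A-modules. Suppose N is a B-module which is flat and finitely generated as an R-module, and such that for every β ∈ Γ the B-module _β N (action b ·_β x = b^β x) is projective. Then φ ⋉_Γ N : P ⋉_Γ N → M ⋉_Γ N is a projective cover in the category of Γ-graded A ⋉_Γ B-modules. -/

import Mathlib

open DirectSum TensorProduct

universe u

variable (Γ : Type u) [Monoid Γ] [DecidableEq Γ] (R : Type u) [CommRing R]
  (A : Type u) [Ring A] [Algebra R A]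

/-- A `Γ`-grading on the `R`-algebra `A`: an internal direct sum decomposition
`A = ⊕_{γ ∈ Γ} A_γ` into `R`-submodules with `1 ∈ A_e` and `A_γ · A_δ ⊆ A_{γδ}`. -/
structure GrAlgebra : Type (u + 1) where
  grading : Γ → Submodule R A
  internal : DirectSum.IsInternal grading
  one_mem : (1 : A) ∈ grading 1
  mul_mem : ∀ {γ δ : Γ} {a b : A},
    a ∈ grading γ → b ∈ grading δ → a * b ∈ grading (γ * δ)

variable (B : Type u) [Ring B] [Algebra R B]

/-- A `Γ`-algebra: an `R`-algebra `B` together with a right action of the monoid `Γ` on `B`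
by `R`-algebra endomorphisms, written `b ↦ b^γ = (act γ) b`. -/
structure GammaAlgebra : Type u where
  act : Γ → B →ₐ[R] B
  act_one : act 1 = AlgHom.id R B
  act_mul : ∀ γ δ : Γ, act (γ * δ) = (act δ).comp (act γ)

variable {Γ R A B}

/-- A `Γ`-graded left `A`-module: the objects of the category `A`-`Γ`-gr. -/
structure GrMod (𝒜 : GrAlgebra Γ R A) : Type (u + 1) where
  carrier : Type u
  [acg : AddCommGroup carrier]
  [modR : Module R carrier]
  [modA : Module A carrier]
  [tower : IsScalarTower R A carrier]
  grading : Γ → Submodule R carrier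
  internal : DirectSum.IsInternal grading
  smul_mem : ∀ {γ δ : Γ} {a : A} {m : carrier},
    a ∈ 𝒜.grading γ → m ∈ grading δ → a • m ∈ grading (γ * δ)

attribute [instance] GrMod.acg GrMod.modR GrMod.modA GrMod.tower

/-- Morphisms of the category `A`-`Γ`-gr. -/
structure GrHom {𝒜 : GrAlgebra Γ R A} (M N : GrMod 𝒜) where
  toLin : M.carrier →ₗ[A] N.carrier
  map_grading : ∀ γ : Γ, ∀ m ∈ M.grading γ, toLin m ∈ N.grading γ

/-- Projectivity in the category `A`-`Γ`-gr (lifting property against surjective graded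
homomorphisms). -/
def GrProjective {𝒜 : GrAlgebra Γ R A} (P : GrMod 𝒜) : Prop :=
  ∀ (M N : GrMod 𝒜) (f : GrHom M N) (g : GrHom P N),
    Function.Surjective f.toLin →
    ∃ h : GrHom P M, f.toLin.comp h.toLin = g.toLin

/-- Graded `A`-submodules of a graded module. -/
def IsGrSubmodule {𝒜 : GrAlgebra Γ R A} (M : GrMod 𝒜) (T : Submodule A M.carrier) : Prop :=
  (⨆ γ : Γ, M.grading γ ⊓ T.restrictScalars R) = T.restrictScalars R

/-- `N` is a superfluous subobject of `M` in the category `A`-`Γ`-gr. -/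
def GrSuperfluous {𝒜 : GrAlgebra Γ R A} (M : GrMod 𝒜) (N : Submodule A M.carrier) : Prop :=
  ∀ T : Submodule A M.carrier, IsGrSubmodule M T → N ⊔ T = ⊤ → T = ⊤

/-- The `B`-module `_β N`: same underlying abelian group as `N`, with the `B`-action
`b ·_β x = b^β • x`. -/
def TwistB (ρ : GammaAlgebra Γ R B) (β : Γ) (N : Type u) : Type u := N

instance (ρ : GammaAlgebra Γ R B) (β : Γ) (N : Type u) [AddCommGroup N] :
    AddCommGroup (TwistB ρ β N) := inferInstanceAs (AddCommGroup N)

instance (ρ : GammaAlgebra Γ R B) (β : Γ) (N : Type u) [AddCommGroup N] [Module R N] :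
    Module R (TwistB ρ β N) := inferInstanceAs (Module R N)

instance (ρ : GammaAlgebra Γ R B) (β : Γ) (N : Type u) [AddCommGroup N] [Module B N] :
    Module B (TwistB ρ β N) := Module.compHom N (ρ.act β).toRingHom

/-- A `Γ`-graded module over the twisted product `A ⋉_Γ B`, where the multiplication of
`A ⋉_Γ B` on the underlying `R`-module `A ⊗[R] B` is the given bilinear map `mul`.
The data is an `R`-bilinear action of `A ⊗[R] B` which is unital and multiplicative for
`mul`, together with an internal grading compatible with the grading of `A ⋉_Γ B`. -/
structure TwModStr (𝒜 : GrAlgebra Γ R A)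
    (mul : (A ⊗[R] B) →ₗ[R] (A ⊗[R] B) →ₗ[R] (A ⊗[R] B))
    (X : Type u) [AddCommGroup X] [Module R X] : Type u where
  act : (A ⊗[R] B) →ₗ[R] X →ₗ[R] X
  one_act : ∀ x : X, act ((1 : A) ⊗ₜ[R] (1 : B)) x = x
  mul_act : ∀ (p q : A ⊗[R] B) (x : X), act (mul p q) x = act p (act q x)
  grading : Γ → Submodule R X
  internal : DirectSum.IsInternal grading
  act_mem : ∀ {γ δ : Γ} {a : A} {b : B} {x : X},
    a ∈ 𝒜.grading γ → x ∈ grading δ → act (a ⊗ₜ[R] b) x ∈ grading (γ * δ)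

/-- Morphisms in the category `(A ⋉_Γ B)`-`Γ`-gr: `R`-linear, `A ⋉_Γ B`-equivariant and
degree preserving maps. -/
def IsTwHom {𝒜 : GrAlgebra Γ R A}
    {mul : (A ⊗[R] B) →ₗ[R] (A ⊗[R] B) →ₗ[R] (A ⊗[R] B)}
    {X Y : Type u} [AddCommGroup X] [Module R X] [AddCommGroup Y] [Module R Y]
    (sX : TwModStr 𝒜 mul X) (sY : TwModStr 𝒜 mul Y) (f : X →ₗ[R] Y) : Prop :=
  (∀ (p : A ⊗[R] B) (x : X), f (sX.act p x) = sY.act p (f x)) ∧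
  (∀ γ : Γ, ∀ x ∈ sX.grading γ, f x ∈ sY.grading γ)

/-- Graded `A ⋉_Γ B`-submodules: `R`-submodules stable under the action and equal to the
sum of their homogeneous components. -/
def IsTwSubmodule {𝒜 : GrAlgebra Γ R A}
    {mul : (A ⊗[R] B) →ₗ[R] (A ⊗[R] B) →ₗ[R] (A ⊗[R] B)}
    {X : Type u} [AddCommGroup X] [Module R X]
    (sX : TwModStr 𝒜 mul X) (T : Submodule R X) : Prop :=
  (∀ (p : A ⊗[R] B), ∀ x ∈ T, sX.act p x ∈ T) ∧
  (⨆ γ : Γ, sX.grading γ ⊓ T) = T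

/-- Projectivity in the category `(A ⋉_Γ B)`-`Γ`-gr (lifting property against surjective
graded homomorphisms). -/
def TwProjective {𝒜 : GrAlgebra Γ R A}
    {mul : (A ⊗[R] B) →ₗ[R] (A ⊗[R] B) →ₗ[R] (A ⊗[R] B)}
    {P : Type u} [AddCommGroup P] [Module R P] (sP : TwModStr 𝒜 mul P) : Prop :=
  ∀ (X Y : Type u) [AddCommGroup X] [Module R X] [AddCommGroup Y] [Module R Y],
    ∀ (sX : TwModStr 𝒜 mul X) (sY : TwModStr 𝒜 mul Y)
      (f : X →ₗ[R] Y) (g : P →ₗ[R] Y),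
      IsTwHom sX sY f → Function.Surjective f → IsTwHom sP sY g →
      ∃ h : P →ₗ[R] X, IsTwHom sP sX h ∧ f.comp h = g

namespace DirectSum.IsInternal

variable {ι S V W : Type*} [DecidableEq ι] [CommRing S] [AddCommGroup V] [Module S V]
  [AddCommGroup W] [Module S W] {𝒱 : ι → Submodule S V} {𝒲 : ι → Submodule S W}

/-- The projection of an internally graded module onto its component of degree `i`. -/
noncomputable def homogeneousPart (h : IsInternal 𝒱) (i : ι) : V →ₗ[S] V :=
  letI := h.chooseDecomposition
  (𝒱 i).subtype ∘ₗ DirectSum.component S ι (fun j => 𝒱 j) i ∘ₗ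
    (decomposeLinearEquiv 𝒱).toLinearMap

theorem homogeneousPart_mem (h : IsInternal 𝒱) (i : ι) (v : V) : h.homogeneousPart i v ∈ 𝒱 i :=
  Subtype.property _

theorem homogeneousPart_same (h : IsInternal 𝒱) {i : ι} {v : V} (hv : v ∈ 𝒱 i) :
    h.homogeneousPart i v = v :=
  let := h.chooseDecomposition
  decompose_of_mem_same 𝒱 hv

theorem homogeneousPart_of_ne (h : IsInternal 𝒱) {i j : ι} {v : V} (hv : v ∈ 𝒱 i) (hij : i ≠ j) :
    h.homogeneousPart j v = 0 :=
  let := h.chooseDecomposition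
  decompose_of_mem_ne 𝒱 hv hij

theorem mem_iSup_inf (h : IsInternal 𝒱) {T : Submodule S V} {v : V}
    (hv : ∀ i, h.homogeneousPart i v ∈ T) : v ∈ ⨆ i, 𝒱 i ⊓ T := by
  classical
  let := h.chooseDecomposition
  rw [← sum_support_decompose 𝒱 v]
  exact Submodule.sum_mem _ fun i _ =>
    Submodule.mem_iSup_of_mem i ⟨h.homogeneousPart_mem i v, hv i⟩

theorem mem_iSup (h : IsInternal 𝒱) (v : V) : v ∈ ⨆ i, 𝒱 i :=
  h.submodule_iSup_eq_top ▸ Submodule.mem_top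

theorem homogeneousPart_mem_of_mem (h : IsInternal 𝒱) {T : Submodule S V}
    (hT : ⨆ i, 𝒱 i ⊓ T = T) {v : V} (hv : v ∈ T) (i : ι) : h.homogeneousPart i v ∈ T := by
  rw [← hT] at hv
  induction hv using Submodule.iSup_induction' with
  | mem j x hx =>
    by_cases hij : j = i
    · subst hij
      rw [h.homogeneousPart_same hx.1]
      exact hx.2
    · rw [h.homogeneousPart_of_ne hx.1 hij]
      exact T.zero_mem
  | zero => simp
  | add x y _ _ hx hy => simpa using T.add_mem hx hy

theorem map_homogeneousPart (h : IsInternal 𝒱) (h' : IsInternal 𝒲) {f : V →ₗ[S] W}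
    (hf : ∀ i, ∀ v ∈ 𝒱 i, f v ∈ 𝒲 i) (i : ι) (v : V) :
    f (h.homogeneousPart i v) = h'.homogeneousPart i (f v) := by
  have hv := h.mem_iSup v
  induction hv using Submodule.iSup_induction' with
  | mem j x hx =>
    by_cases hij : j = i
    · subst hij
      rw [h.homogeneousPart_same hx, h'.homogeneousPart_same (hf _ _ hx)]
    · rw [h.homogeneousPart_of_ne hx hij, h'.homogeneousPart_of_ne (hf _ _ hx) hij, map_zero]
  | zero => simp
  | add x y _ _ hx hy => simp [hx, hy]

theorem exists_mem_of_surjective (h : IsInternal 𝒱) (h' : IsInternal 𝒲) {f : V →ₗ[S] W}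
    (hf : ∀ i, ∀ v ∈ 𝒱 i, f v ∈ 𝒲 i) (hs : Function.Surjective f) {i : ι} {w : W}
    (hw : w ∈ 𝒲 i) : ∃ v ∈ 𝒱 i, f v = w := by
  obtain ⟨v, rfl⟩ := hs w
  exact ⟨_, h.homogeneousPart_mem i v, by
    rw [h.map_homogeneousPart h' hf, h'.homogeneousPart_same hw]⟩

theorem iSup_inf_comap (h : IsInternal 𝒱) (h' : IsInternal 𝒲) {f : V →ₗ[S] W}
    (hf : ∀ i, ∀ v ∈ 𝒱 i, f v ∈ 𝒲 i) {T : Submodule S W} (hT : ⨆ i, 𝒲 i ⊓ T = T) :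
    ⨆ i, 𝒱 i ⊓ T.comap f = T.comap f := by
  refine le_antisymm (iSup_le fun _ => inf_le_right) fun v hv => h.mem_iSup_inf fun i => ?_
  rw [Submodule.mem_comap, h.map_homogeneousPart h' hf]
  exact h'.homogeneousPart_mem_of_mem hT hv i

theorem tensor_hom_ext (h : IsInternal 𝒱) {N : Type*} [AddCommGroup N] [Module S N]
    {f g : V ⊗[S] N →ₗ[S] W} (hfg : ∀ i, ∀ v ∈ 𝒱 i, ∀ x : N, f (v ⊗ₜ x) = g (v ⊗ₜ x)) :
    f = g := by
  refine TensorProduct.ext' fun v x => ?_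
  have hv := h.mem_iSup v
  induction hv using Submodule.iSup_induction' with
  | mem i v hv => exact hfg i v hv x
  | zero => simp
  | add v w _ _ hv hw => simp [add_tmul, hv, hw]

end DirectSum.IsInternal

theorem iSup_inf_sup_eq {ι S V : Type*} [CommRing S] [AddCommGroup V] [Module S V]
    {𝒱 : ι → Submodule S V} {T U : Submodule S V} (hT : ⨆ i, 𝒱 i ⊓ T = T)
    (hU : ⨆ i, 𝒱 i ⊓ U = U) : ⨆ i, 𝒱 i ⊓ (T ⊔ U) = T ⊔ U := by
  refine le_antisymm (iSup_le fun _ => inf_le_right) (sup_le ?_ ?_)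
  · exact hT.symm.le.trans (iSup_mono fun _ => inf_le_inf_left _ le_sup_left)
  · exact hU.symm.le.trans (iSup_mono fun _ => inf_le_inf_left _ le_sup_right)

theorem iSup_inf_map_eq {ι S V W : Type*} [CommRing S] [AddCommGroup V] [Module S V]
    [AddCommGroup W] [Module S W] {𝒱 : ι → Submodule S V} {𝒲 : ι → Submodule S W}
    {f : V →ₗ[S] W} (hf : ∀ i, ∀ v ∈ 𝒱 i, f v ∈ 𝒲 i) {T : Submodule S V}
    (hT : ⨆ i, 𝒱 i ⊓ T = T) : ⨆ i, 𝒲 i ⊓ T.map f = T.map f := by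
  refine le_antisymm (iSup_le fun _ => inf_le_right) ?_
  conv_lhs => rw [← hT]
  rw [Submodule.map_iSup]
  refine iSup_mono fun i => ?_
  rintro _ ⟨v, ⟨hv, hvT⟩, rfl⟩
  exact ⟨hf i v hv, v, hvT, rfl⟩

theorem DirectSum.isInternal_comap_subtype_iSup {ι S V : Type*} [DecidableEq ι] [CommRing S]
    [AddCommGroup V] [Module S V] {𝒱 : ι → Submodule S V} (h : iSupIndep 𝒱) :
    IsInternal fun i => (𝒱 i).comap (⨆ i, 𝒱 i).subtype := by
  refine isInternal_submodule_of_iSupIndep_of_iSup_eq_top (fun i => ?_) ?_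
  · rw [Submodule.disjoint_def]
    intro v hv hv'
    refine Subtype.ext (Submodule.disjoint_def.1 (h i) v hv ?_)
    have := Submodule.mem_map_of_mem (f := (⨆ i, 𝒱 i).subtype) hv'
    simp only [Submodule.map_iSup] at this
    exact iSup₂_mono (fun j _ => Submodule.map_comap_le _ _) this
  · refine eq_top_iff.2 ?_
    rintro ⟨v, hv⟩ -
    induction hv using Submodule.iSup_induction' with
    | mem i v hv => exact Submodule.mem_iSup_of_mem i hv
    | zero => exact Submodule.zero_mem _
    | add v w hv hw h1 h2 => exact Submodule.add_mem _ h1 h2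

section HomModule

variable {𝒜 : GrAlgebra Γ R A}
  (ρ : GammaAlgebra Γ R B) {mul : (A ⊗[R] B) →ₗ[R] (A ⊗[R] B) →ₗ[R] (A ⊗[R] B)}
  {X Y : Type u} [AddCommGroup X] [Module R X] [AddCommGroup Y] [Module R Y]
  (N : Type u) [AddCommGroup N] [Module R N] [Module B N]

/-- The `R`-linear maps `N → X_γ` that are `B`-linear as maps `_γ N → X_γ`. -/
def homGrading (sX : TwModStr 𝒜 mul X) (γ : Γ) : Submodule R (N →ₗ[R] X) where
  carrier := {k | (∀ x, k x ∈ sX.grading γ) ∧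
    ∀ b x, k (ρ.act γ b • x) = sX.act (1 ⊗ₜ b) (k x)}
  add_mem' hk hl := ⟨fun x => add_mem (hk.1 x) (hl.1 x), fun b x => by
    simp [hk.2, hl.2]⟩
  zero_mem' := by simp
  smul_mem' r k hk := ⟨fun x => Submodule.smul_mem _ r (hk.1 x), fun b x => by simp [hk.2]⟩

variable {ρ N}

theorem iSupIndep_homGrading (sX : TwModStr 𝒜 mul X) : iSupIndep (homGrading ρ N sX) := by
  intro γ
  rw [Submodule.disjoint_def]
  intro k hk hk'
  ext x
  refine Submodule.disjoint_def.1 (sX.internal.submodule_iSupIndep γ) (k x) (hk.1 x) ?_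
  have := Submodule.mem_map_of_mem (f := LinearMap.applyₗ x) hk'
  simp only [Submodule.map_iSup] at this
  refine (iSup₂_mono fun j _ => ?_ : _ ≤ ⨆ j, ⨆ (_ : j ≠ γ), sX.grading j) this
  rintro _ ⟨l, hl, rfl⟩
  exact hl.1 x

variable (hmul : ∀ (β : Γ) (a a' : A) (b b' : B), a' ∈ 𝒜.grading β →
      mul (a ⊗ₜ[R] b) (a' ⊗ₜ[R] b') = (a * a') ⊗ₜ[R] (ρ.act β b * b'))
include hmul

theorem TwModStr.act_tmul_one_act (sX : TwModStr 𝒜 mul X) (a : A) (b : B) (x : X) :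
    sX.act (a ⊗ₜ 1) (sX.act (1 ⊗ₜ b) x) = sX.act (a ⊗ₜ b) x := by
  rw [← sX.mul_act, hmul 1 _ _ _ _ 𝒜.one_mem]
  simp

theorem TwModStr.act_mul_tmul_one (sX : TwModStr 𝒜 mul X) (a a' : A) (x : X) :
    sX.act ((a * a') ⊗ₜ 1) x = sX.act (a ⊗ₜ 1) (sX.act (a' ⊗ₜ 1) x) := by
  have ha' := 𝒜.internal.mem_iSup a'
  induction ha' using Submodule.iSup_induction' with
  | mem α a' ha' => rw [← sX.mul_act, hmul α _ _ _ _ ha']; simp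
  | zero => simp
  | add a₁ a₂ _ _ h₁ h₂ => simp [mul_add, add_tmul, h₁, h₂]

theorem comp_mem_homGrading (sX : TwModStr 𝒜 mul X) {α γ : Γ} {a : A} {k : N →ₗ[R] X}
    (ha : a ∈ 𝒜.grading α) (hk : k ∈ homGrading ρ N sX γ) :
    sX.act (a ⊗ₜ 1) ∘ₗ k ∈ homGrading ρ N sX (α * γ) := by
  refine ⟨fun x => sX.act_mem ha (hk.1 x), fun b x => ?_⟩
  simp only [LinearMap.comp_apply, ρ.act_mul, AlgHom.comp_apply, hk.2]
  rw [sX.act_tmul_one_act hmul, ← sX.mul_act, hmul α _ _ _ _ ha]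
  simp

theorem comp_mem_iSup_homGrading (sX : TwModStr 𝒜 mul X) (a : A) {k : N →ₗ[R] X}
    (hk : k ∈ ⨆ γ, homGrading ρ N sX γ) :
    sX.act (a ⊗ₜ 1) ∘ₗ k ∈ ⨆ γ, homGrading ρ N sX γ := by
  induction hk using Submodule.iSup_induction' with
  | mem γ k hk =>
    have ha := 𝒜.internal.mem_iSup a
    induction ha using Submodule.iSup_induction' with
    | mem α a ha => exact Submodule.mem_iSup_of_mem _ (comp_mem_homGrading hmul sX ha hk)
    | zero => simp
    | add a₁ a₂ _ _ h₁ h₂ => simpa [add_tmul, LinearMap.add_comp] using add_mem h₁ h₂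
  | zero => simp
  | add k l _ _ hk hl => simpa [LinearMap.comp_add] using add_mem hk hl

variable (N) in
/-- The graded `A`-module `⊕_γ Hom_B(_γ N, X_γ)`. The functor `X ↦ homModule X` is right adjoint
to `P ↦ P ⋉_Γ N`. -/
def homModule (sX : TwModStr 𝒜 mul X) : GrMod 𝒜 :=
  letI : Module A ↥(⨆ γ, homGrading ρ N sX γ) :=
    { smul := fun a k => ⟨sX.act (a ⊗ₜ 1) ∘ₗ k.1, comp_mem_iSup_homGrading hmul sX a k.2⟩
      one_smul := fun k => Subtype.ext (LinearMap.ext fun x => sX.one_act _)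
      mul_smul := fun a a' k =>
        Subtype.ext (LinearMap.ext fun x => sX.act_mul_tmul_one hmul a a' _)
      smul_zero := fun a => Subtype.ext (LinearMap.comp_zero _)
      smul_add := fun a k l => Subtype.ext (LinearMap.comp_add _ _ _)
      add_smul := fun a a' k => Subtype.ext (LinearMap.ext fun x => by
        change sX.act ((a + a') ⊗ₜ 1) (k.1 x) =
          sX.act (a ⊗ₜ 1) (k.1 x) + sX.act (a' ⊗ₜ 1) (k.1 x)
        simp [add_tmul])
      zero_smul := fun k => Subtype.ext (LinearMap.ext fun x => by
        change sX.act (0 ⊗ₜ 1) (k.1 x) = 0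
        simp) }
  { carrier := ↥(⨆ γ, homGrading ρ N sX γ)
    tower := ⟨fun r a k => Subtype.ext (LinearMap.ext fun x => by
      change sX.act ((r • a) ⊗ₜ 1) (k.1 x) = r • sX.act (a ⊗ₜ 1) (k.1 x)
      simp [← smul_tmul'])⟩
    grading := fun γ => (homGrading ρ N sX γ).comap (⨆ γ, homGrading ρ N sX γ).subtype
    internal := DirectSum.isInternal_comap_subtype_iSup (iSupIndep_homGrading sX)
    smul_mem := fun ha hk => comp_mem_homGrading hmul sX ha hk }

/-- The graded homomorphism `homModule X → homModule Y` given by composition with `f : X → Y`. -/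
def homModuleMap {sX : TwModStr 𝒜 mul X} {sY : TwModStr 𝒜 mul Y} {f : X →ₗ[R] Y}
    (hf : IsTwHom sX sY f) : GrHom (homModule N hmul sX) (homModule N hmul sY) :=
  have hmem : ∀ {γ} {k : N →ₗ[R] X}, k ∈ homGrading ρ N sX γ → f ∘ₗ k ∈ homGrading ρ N sY γ :=
    fun hk => ⟨fun x => hf.2 _ _ (hk.1 x), fun b x => by simp [hk.2, hf.1]⟩
  { toLin :=
      { toFun := fun k => ⟨f ∘ₗ k.1, by
          have : (⨆ γ, homGrading ρ N sX γ) ≤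
              (⨆ γ, homGrading ρ N sY γ).comap (LinearMap.compRight R f) :=
            iSup_le fun γ k hk => Submodule.mem_iSup_of_mem γ (hmem hk)
          exact this k.2⟩
        map_add' := fun k l => Subtype.ext (LinearMap.comp_add _ _ _)
        map_smul' := fun a k => Subtype.ext (LinearMap.ext fun x => hf.1 _ _) }
    map_grading := fun γ k hk => hmem hk }

/-- The `B`-module structure on a homogeneous component of a graded module over the twisted
product. -/
abbrev gradingModule (sX : TwModStr 𝒜 mul X) (γ : Γ) : Module B (sX.grading γ) where
  smul b x := ⟨sX.act (1 ⊗ₜ b) x, by simpa using sX.act_mem (b := b) 𝒜.one_mem x.2⟩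
  one_smul x := Subtype.ext (sX.one_act _)
  mul_smul b b' x := Subtype.ext <| by
    change sX.act (1 ⊗ₜ (b * b')) x = sX.act (1 ⊗ₜ b) (sX.act (1 ⊗ₜ b') x)
    rw [← sX.mul_act, hmul 1 _ _ _ _ 𝒜.one_mem, ρ.act_one]
    simp
  smul_zero b := Subtype.ext (map_zero _)
  smul_add b x y := Subtype.ext (map_add _ _ _)
  add_smul b b' x := Subtype.ext <| by
    change sX.act (1 ⊗ₜ (b + b')) x = sX.act (1 ⊗ₜ b) x + sX.act (1 ⊗ₜ b') x
    simp [tmul_add]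
  zero_smul x := Subtype.ext <| by
    change sX.act (1 ⊗ₜ 0) x = 0
    simp

variable [IsScalarTower R B N]

theorem exists_comp_eq_of_mem_homGrading {γ : Γ} [Module.Projective B (TwistB ρ γ N)]
    {sX : TwModStr 𝒜 mul X} {sY : TwModStr 𝒜 mul Y} {f : X →ₗ[R] Y}
    (hf : IsTwHom sX sY f) (hs : Function.Surjective f) {k : N →ₗ[R] Y}
    (hk : k ∈ homGrading ρ N sY γ) : ∃ l ∈ homGrading ρ N sX γ, f ∘ₗ l = k := by
  let := gradingModule hmul sX γ
  let := gradingModule hmul sY γ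
  let fγ : sX.grading γ →ₗ[B] sY.grading γ :=
    { toFun := fun x => ⟨f x, hf.2 γ x x.2⟩
      map_add' := fun x y => Subtype.ext (map_add _ _ _)
      map_smul' := fun b x => Subtype.ext (hf.1 _ _) }
  let kγ : TwistB ρ γ N →ₗ[B] sY.grading γ :=
    { toFun := fun x => ⟨k x, hk.1 x⟩
      map_add' := fun x y => Subtype.ext (map_add k _ _)
      map_smul' := fun b x => Subtype.ext (hk.2 b x) }
  have hfγ : Function.Surjective fγ := fun y => by
    obtain ⟨x, hx, hxy⟩ := sX.internal.exists_mem_of_surjective sY.internal hf.2 hs y.2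
    exact ⟨⟨x, hx⟩, Subtype.ext hxy⟩
  obtain ⟨l, hl⟩ := Module.projective_lifting_property fγ kγ hfγ
  have hlB (b : B) (x : N) :
      (l (ρ.act γ b • x : N) : X) = sX.act (1 ⊗ₜ b) (l x : sX.grading γ) :=
    congrArg Subtype.val (l.map_smul b x)
  refine ⟨⟨⟨fun x => l x, fun x y => congrArg Subtype.val (l.map_add x y)⟩, fun r x => ?_⟩,
    ⟨fun x => (l x).2, hlB⟩, LinearMap.ext fun x => congrArg Subtype.val (LinearMap.congr_fun hl x)⟩
  have := hlB (algebraMap R B r) x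
  rw [AlgHom.commutes, algebraMap_smul, Algebra.algebraMap_eq_smul_one, tmul_smul, map_smul,
    LinearMap.smul_apply, sX.one_act] at this
  exact this

theorem homModuleMap_surjective (hNproj : ∀ β : Γ, Module.Projective B (TwistB ρ β N))
    {sX : TwModStr 𝒜 mul X} {sY : TwModStr 𝒜 mul Y} {f : X →ₗ[R] Y}
    (hf : IsTwHom sX sY f) (hs : Function.Surjective f) :
    Function.Surjective (homModuleMap (N := N) hmul hf).toLin := by
  rintro ⟨k, hk⟩
  induction hk using Submodule.iSup_induction' with
  | mem γ k hk =>
    obtain ⟨l, hl, h⟩ := exists_comp_eq_of_mem_homGrading hmul hf hs hk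
    exact ⟨⟨l, Submodule.mem_iSup_of_mem γ hl⟩, Subtype.ext h⟩
  | zero => exact ⟨0, map_zero _⟩
  | add k l _ _ hk hl =>
    obtain ⟨k', hk'⟩ := hk
    obtain ⟨l', hl'⟩ := hl
    exact ⟨k' + l', by rw [map_add, hk', hl']; rfl⟩

end HomModule

section TwistedProduct

variable {𝒜 : GrAlgebra Γ R A} {ρ : GammaAlgebra Γ R B}
  {mul : (A ⊗[R] B) →ₗ[R] (A ⊗[R] B) →ₗ[R] (A ⊗[R] B)}
  {N : Type u} [AddCommGroup N] [Module R N]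
  {P M : GrMod 𝒜} {sP : TwModStr 𝒜 mul (P.carrier ⊗[R] N)}
  {sM : TwModStr 𝒜 mul (M.carrier ⊗[R] N)}

theorem TwModStr.tmul_mem_grading
    (hgrP : ∀ γ : Γ, sP.grading γ =
      LinearMap.range (TensorProduct.map (P.grading γ).subtype (LinearMap.id : N →ₗ[R] N)))
    {γ : Γ} {p : P.carrier} (hp : p ∈ P.grading γ) (x : N) : p ⊗ₜ[R] x ∈ sP.grading γ := by
  rw [hgrP]
  exact ⟨(⟨p, hp⟩ : P.grading γ) ⊗ₜ x, rfl⟩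

variable [Module B N]

theorem TwModStr.act_tmul_one_tmul
    (hactP : ∀ (γ : Γ) (a : A) (b : B) (m : P.carrier) (x : N), m ∈ P.grading γ →
      sP.act (a ⊗ₜ[R] b) (m ⊗ₜ[R] x) = (a • m) ⊗ₜ[R] (ρ.act γ b • x))
    (a : A) (p : P.carrier) (x : N) : sP.act (a ⊗ₜ 1) (p ⊗ₜ x) = (a • p) ⊗ₜ x := by
  have hp := P.internal.mem_iSup p
  induction hp using Submodule.iSup_induction' with
  | mem γ p hp => simp [hactP γ _ _ _ _ hp]
  | zero => simp
  | add p q _ _ hp hq => simp [add_tmul, hp, hq]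

theorem isTwHom_map (φ : GrHom P M)
    (hactP : ∀ (γ : Γ) (a : A) (b : B) (m : P.carrier) (x : N), m ∈ P.grading γ →
      sP.act (a ⊗ₜ[R] b) (m ⊗ₜ[R] x) = (a • m) ⊗ₜ[R] (ρ.act γ b • x))
    (hgrP : ∀ γ : Γ, sP.grading γ =
      LinearMap.range (TensorProduct.map (P.grading γ).subtype (LinearMap.id : N →ₗ[R] N)))
    (hactM : ∀ (γ : Γ) (a : A) (b : B) (m : M.carrier) (x : N), m ∈ M.grading γ →
      sM.act (a ⊗ₜ[R] b) (m ⊗ₜ[R] x) = (a • m) ⊗ₜ[R] (ρ.act γ b • x))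
    (hgrM : ∀ γ : Γ, sM.grading γ =
      LinearMap.range (TensorProduct.map (M.grading γ).subtype (LinearMap.id : N →ₗ[R] N))) :
    IsTwHom sP sM (TensorProduct.map (φ.toLin.restrictScalars R) LinearMap.id) := by
  refine ⟨fun q => LinearMap.congr_fun (f := TensorProduct.map _ _ ∘ₗ sP.act q)
    (g := sM.act q ∘ₗ TensorProduct.map _ _) ?_, fun γ => ?_⟩
  · induction q with
    | zero => simp
    | add q q' hq hq' => simp only [map_add, LinearMap.comp_add, LinearMap.add_comp, hq, hq']
    | tmul a b =>
      refine P.internal.tensor_hom_ext fun γ p hp x => ?_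
      simp [hactP γ _ _ _ _ hp, hactM γ _ _ _ _ (φ.map_grading γ p hp)]
  · rw [hgrP]
    rintro _ ⟨t, rfl⟩
    induction t with
    | zero => simp
    | add t t' ht ht' => simpa only [map_add] using add_mem ht ht'
    | tmul p x => exact TwModStr.tmul_mem_grading hgrM (φ.map_grading γ p p.2) x

theorem twProjective_twistedProduct [IsScalarTower R B N]
    (hmul : ∀ (β : Γ) (a a' : A) (b b' : B), a' ∈ 𝒜.grading β →
      mul (a ⊗ₜ[R] b) (a' ⊗ₜ[R] b') = (a * a') ⊗ₜ[R] (ρ.act β b * b'))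
    (hNproj : ∀ β : Γ, Module.Projective B (TwistB ρ β N)) (hPproj : GrProjective P)
    (hactP : ∀ (γ : Γ) (a : A) (b : B) (m : P.carrier) (x : N), m ∈ P.grading γ →
      sP.act (a ⊗ₜ[R] b) (m ⊗ₜ[R] x) = (a • m) ⊗ₜ[R] (ρ.act γ b • x))
    (hgrP : ∀ γ : Γ, sP.grading γ =
      LinearMap.range (TensorProduct.map (P.grading γ).subtype (LinearMap.id : N →ₗ[R] N))) :
    TwProjective sP := by
  intro X Y _ _ _ _ sX sY f g hf hs hg
  have hcurry {γ : Γ} {p : P.carrier} (hp : p ∈ P.grading γ) :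
      TensorProduct.curry g p ∈ homGrading ρ N sY γ := by
    refine ⟨fun x => hg.2 _ _ (TwModStr.tmul_mem_grading hgrP hp x), fun b x => ?_⟩
    rw [TensorProduct.curry_apply, TensorProduct.curry_apply, ← hg.1, hactP γ _ _ _ _ hp, one_smul]
  let g' : GrHom P (homModule N hmul sY) :=
    { toLin :=
        { toFun := fun p => ⟨TensorProduct.curry g p, by
            have : (⨆ γ, P.grading γ) ≤
                (⨆ γ, homGrading ρ N sY γ).comap (TensorProduct.curry g) :=
              iSup_le fun γ p hp => Submodule.mem_iSup_of_mem γ (hcurry hp)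
            exact this (P.internal.mem_iSup p)⟩
          map_add' := fun p q => Subtype.ext (map_add _ _ _)
          map_smul' := fun a p => Subtype.ext <| LinearMap.ext fun x => by
            change g ((a • p) ⊗ₜ x) = sY.act (a ⊗ₜ 1) (g (p ⊗ₜ x))
            rw [← hg.1, TwModStr.act_tmul_one_tmul hactP] }
      map_grading := fun γ p hp => hcurry hp }
  obtain ⟨h, hh⟩ := hPproj _ _ (homModuleMap hmul hf) g' (homModuleMap_surjective hmul hNproj hf hs)
  let h' : P.carrier →ₗ[R] N →ₗ[R] X :=
    { toFun := fun p => (h.toLin p).1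
      map_add' := fun p q => congrArg Subtype.val (map_add h.toLin p q)
      map_smul' := fun r p => by
        have : h.toLin (r • p) = algebraMap R A r • h.toLin p := by
          rw [← map_smul, algebraMap_smul]
        rw [algebraMap_smul] at this
        exact congrArg Subtype.val this }
  have hsmul (a : A) (p : P.carrier) (x : N) : h' (a • p) x = sX.act (a ⊗ₜ 1) (h' p x) :=
    LinearMap.congr_fun (congrArg Subtype.val (h.toLin.map_smul a p)) x
  have hmem {γ : Γ} {p : P.carrier} (hp : p ∈ P.grading γ) : h' p ∈ homGrading ρ N sX γ :=
    h.map_grading γ p hp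
  refine ⟨TensorProduct.lift h', ⟨fun q => LinearMap.congr_fun
    (f := TensorProduct.lift h' ∘ₗ sP.act q) (g := sX.act q ∘ₗ TensorProduct.lift h') ?_,
    fun γ => ?_⟩, TensorProduct.ext' fun p x =>
    LinearMap.congr_fun (congrArg Subtype.val (LinearMap.congr_fun hh p)) x⟩
  · induction q with
    | zero => simp
    | add q q' hq hq' => simp only [map_add, LinearMap.comp_add, LinearMap.add_comp, hq, hq']
    | tmul a b =>
      refine P.internal.tensor_hom_ext fun γ p hp x => ?_
      rw [LinearMap.comp_apply, LinearMap.comp_apply, hactP γ _ _ _ _ hp, TensorProduct.lift.tmul,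
        TensorProduct.lift.tmul, hsmul, (hmem hp).2 b x]
      exact sX.act_tmul_one_act hmul a b _
  · rw [hgrP]
    rintro _ ⟨t, rfl⟩
    induction t with
    | zero => simp
    | add t t' ht ht' => simpa only [map_add] using add_mem ht ht'
    | tmul p x => exact (hmem p.2).1 x

theorem GrSuperfluous.eq_top_of_map_sup {K : Submodule A P.carrier} (hK : GrSuperfluous P K)
    (hactP : ∀ (γ : Γ) (a : A) (b : B) (m : P.carrier) (x : N), m ∈ P.grading γ →
      sP.act (a ⊗ₜ[R] b) (m ⊗ₜ[R] x) = (a • m) ⊗ₜ[R] (ρ.act γ b • x))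
    (hgrP : ∀ γ : Γ, sP.grading γ =
      LinearMap.range (TensorProduct.map (P.grading γ).subtype (LinearMap.id : N →ₗ[R] N)))
    {T : Submodule R (P.carrier ⊗[R] N)} (hact : ∀ (a : A), ∀ t ∈ T, sP.act (a ⊗ₜ 1) t ∈ T)
    (hgr : ⨆ γ, sP.grading γ ⊓ T = T) (x : N)
    (hT : (K.restrictScalars R).map ((TensorProduct.mk R P.carrier N).flip x) ⊔ T = ⊤) :
    T = ⊤ := by
  let ψ := (TensorProduct.mk R P.carrier N).flip x
  let U : Submodule A P.carrier :=
    { (T.comap ψ) with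
      smul_mem' := fun a p hp => by
        change (a • p) ⊗ₜ x ∈ T
        rw [← TwModStr.act_tmul_one_tmul hactP]
        exact hact a _ hp }
  have hU : U = ⊤ := by
    refine hK U (P.internal.iSup_inf_comap sP.internal
      (fun γ p hp => TwModStr.tmul_mem_grading hgrP hp x) hgr) (eq_top_iff.2 fun p _ => ?_)
    obtain ⟨_, ⟨k, hk, rfl⟩, t, ht, hkt⟩ :=
      Submodule.mem_sup.1 (hT ▸ Submodule.mem_top : ψ p ∈ _)
    refine Submodule.mem_sup.2 ⟨k, hk, p - k, ?_, add_sub_cancel _ _⟩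
    change ψ (p - k) ∈ T
    rw [map_sub, ← hkt, add_sub_cancel_left]
    exact ht
  rw [← hT, right_eq_sup]
  rintro _ ⟨k, -, rfl⟩
  exact (hU ▸ Submodule.mem_top : k ∈ U)

theorem GrSuperfluous.eq_top_of_biSup_map_sup {K : Submodule A P.carrier}
    (hK : GrSuperfluous P K) (hKgr : IsGrSubmodule P K)
    (hactP : ∀ (γ : Γ) (a : A) (b : B) (m : P.carrier) (x : N), m ∈ P.grading γ →
      sP.act (a ⊗ₜ[R] b) (m ⊗ₜ[R] x) = (a • m) ⊗ₜ[R] (ρ.act γ b • x))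
    (hgrP : ∀ γ : Γ, sP.grading γ =
      LinearMap.range (TensorProduct.map (P.grading γ).subtype (LinearMap.id : N →ₗ[R] N)))
    (s : Finset N) {T : Submodule R (P.carrier ⊗[R] N)}
    (hact : ∀ (a : A), ∀ t ∈ T, sP.act (a ⊗ₜ 1) t ∈ T) (hgr : ⨆ γ, sP.grading γ ⊓ T = T)
    (hT : (⨆ x ∈ s, (K.restrictScalars R).map ((TensorProduct.mk R P.carrier N).flip x)) ⊔ T = ⊤) :
    T = ⊤ := by
  classical
  induction s using Finset.induction_on generalizing T with
  | empty => simpa using hT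
  | insert x s _ ih =>
    refine hK.eq_top_of_map_sup hactP hgrP hact hgr x (ih ?_ ?_ ?_)
    · intro a t ht
      obtain ⟨_, ⟨k, hk, rfl⟩, t, htT, rfl⟩ := Submodule.mem_sup.1 ht
      rw [map_add]
      refine Submodule.add_mem_sup ⟨a • k, K.smul_mem a hk, ?_⟩ (hact a t htT)
      exact (TwModStr.act_tmul_one_tmul hactP a k x).symm
    · exact iSup_inf_sup_eq (iSup_inf_map_eq (𝒱 := P.grading)
        (fun γ p hp => TwModStr.tmul_mem_grading hgrP hp x) hKgr) hgr
    · rw [← hT, Finset.iSup_insert, ← sup_assoc, sup_comm (⨆ x ∈ s, _)]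

end TwistedProduct

theorem ker_map_id_le_biSup_map {S V W N : Type*} [CommRing S] [AddCommGroup V] [Module S V]
    [AddCommGroup W] [Module S W] [AddCommGroup N] [Module S N] {f : V →ₗ[S] W}
    (hf : Function.Surjective f) {s : Set N} (hs : Submodule.span S s = ⊤) :
    LinearMap.ker (TensorProduct.map f (LinearMap.id : N →ₗ[S] N)) ≤
      ⨆ x ∈ s, (LinearMap.ker f).map ((TensorProduct.mk S V N).flip x) := by
  change LinearMap.ker (LinearMap.rTensor N f) ≤ _
  rw [(_root_.rTensor_exact N (LinearMap.exact_subtype_ker_map f) hf).linearMap_ker_eq]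
  rintro _ ⟨t, rfl⟩
  induction t with
  | zero => simp
  | add t t' h h' => simpa only [map_add] using add_mem h h'
  | tmul k x =>
    rw [LinearMap.rTensor_tmul]
    have hx : x ∈ Submodule.span S s := hs ▸ Submodule.mem_top
    induction hx using Submodule.span_induction with
    | mem x hx => exact Submodule.mem_iSup_of_mem x (Submodule.mem_iSup_of_mem hx ⟨k, k.2, rfl⟩)
    | zero => simp
    | add x y _ _ hx hy => simpa only [tmul_add] using add_mem hx hy
    | smul r x _ hx => simpa only [tmul_smul] using Submodule.smul_mem _ r hx

/-- If `φ : P → M` is a projective cover in `A`-`Γ`-gr and `N` is a `B`-module which is flat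
and finitely generated over `R` and such that every twist `_β N` is a projective
`B`-module, then `φ ⋉_Γ N : P ⋉_Γ N → M ⋉_Γ N` is a projective cover in the category of
`Γ`-graded `A ⋉_Γ B`-modules. -/
theorem twistedProduct_projective_cover {Γ R A B : Type u} [Monoid Γ] [DecidableEq Γ]
    [CommRing R] [Ring A] [Algebra R A] [Ring B] [Algebra R B]
    (𝒜 : GrAlgebra Γ R A) (ρ : GammaAlgebra Γ R B)
    (mul : (A ⊗[R] B) →ₗ[R] (A ⊗[R] B) →ₗ[R] (A ⊗[R] B))
    (hmul : ∀ (β : Γ) (a a' : A) (b b' : B), a' ∈ 𝒜.grading β →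
      mul (a ⊗ₜ[R] b) (a' ⊗ₜ[R] b') = (a * a') ⊗ₜ[R] (ρ.act β b * b'))
    (N : Type u) [AddCommGroup N] [Module R N] [Module B N] [IsScalarTower R B N]
    [Module.Finite R N] [Module.Flat R N]
    (hNproj : ∀ β : Γ, Module.Projective B (TwistB ρ β N))
    (P M : GrMod 𝒜) (φ : GrHom P M)
    -- `φ` is a projective cover in `A`-`Γ`-gr:
    (hPproj : GrProjective P) (hφsurj : Function.Surjective φ.toLin)
    (hker : GrSuperfluous P (LinearMap.ker φ.toLin))
    (sP : TwModStr 𝒜 mul (P.carrier ⊗[R] N)) (sM : TwModStr 𝒜 mul (M.carrier ⊗[R] N))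
    (hactP : ∀ (γ : Γ) (a : A) (b : B) (m : P.carrier) (x : N), m ∈ P.grading γ →
      sP.act (a ⊗ₜ[R] b) (m ⊗ₜ[R] x) = (a • m) ⊗ₜ[R] (ρ.act γ b • x))
    (hgrP : ∀ γ : Γ, sP.grading γ =
      LinearMap.range (TensorProduct.map (P.grading γ).subtype
        (LinearMap.id : N →ₗ[R] N)))
    (hactM : ∀ (γ : Γ) (a : A) (b : B) (m : M.carrier) (x : N), m ∈ M.grading γ →
      sM.act (a ⊗ₜ[R] b) (m ⊗ₜ[R] x) = (a • m) ⊗ₜ[R] (ρ.act γ b • x))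
    (hgrM : ∀ γ : Γ, sM.grading γ =
      LinearMap.range (TensorProduct.map (M.grading γ).subtype
        (LinearMap.id : N →ₗ[R] N))) :
    -- `φ ⋉_Γ N` is a projective cover in `(A ⋉_Γ B)`-`Γ`-gr:
    IsTwHom sP sM (TensorProduct.map (φ.toLin.restrictScalars R)
      (LinearMap.id : N →ₗ[R] N)) ∧
    Function.Surjective (TensorProduct.map (φ.toLin.restrictScalars R)
      (LinearMap.id : N →ₗ[R] N)) ∧
    TwProjective sP ∧
    (∀ T : Submodule R (P.carrier ⊗[R] N), IsTwSubmodule sP T →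
      LinearMap.ker (TensorProduct.map (φ.toLin.restrictScalars R)
        (LinearMap.id : N →ₗ[R] N)) ⊔ T = ⊤ → T = ⊤) := by
  refine ⟨isTwHom_map φ hactP hgrP hactM hgrM,
    TensorProduct.map_surjective hφsurj Function.surjective_id,
    twProjective_twistedProduct hmul hNproj hPproj hactP hgrP, fun T hT hker_sup => ?_⟩
  obtain ⟨s, hs⟩ := Module.Finite.fg_top (R := R) (M := N)
  have hKgr : IsGrSubmodule P (LinearMap.ker φ.toLin) :=
    P.internal.iSup_inf_comap (f := φ.toLin.restrictScalars R) M.internal φ.map_grading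
      (T := ⊥) (by simp)
  refine hker.eq_top_of_biSup_map_sup hKgr hactP hgrP s (fun a => hT.1 _) hT.2 ?_
  exact top_le_iff.1 (hker_sup.ge.trans (sup_le_sup_right
    (ker_map_id_le_biSup_map (f := φ.toLin.restrictScalars R) hφsurj hs) T))
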